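/- Let (X, d) be a metric space and T : X → X a nonexpansive map. For every u ∈ X and every v ∈ ω(u), the ω-limit set ω(u) equals the closure of the forward orbit {T^n v : n ∈ ℕ}; in particular the restriction of T to ω(u) is minimal. -/

import Mathlib

/-- The ω-limit set of a point `u` under iteration of `T`: the set of points `w` such that
for every `ε > 0` and every `N` there exists `k ≥ N` with `dist (T^[k] u) w < ε`. -/
def omegaLimitSet {X : Type*} [MetricSpace X] (T : X → X) (u : X) : Set X :=
  {w | ∀ ε > (0 : ℝ), ∀ N : ℕ, ∃ k ≥ N, dist (T^[k] u) w < ε}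

theorem dist_iterate_le_of_nonexpansive {X : Type*} [PseudoMetricSpace X] {T : X → X}
    (hT : ∀ a b : X, dist (T a) (T b) ≤ dist a b) (n : ℕ) (a b : X) :
    dist (T^[n] a) (T^[n] b) ≤ dist a b := by
  have h : LipschitzWith 1 T := LipschitzWith.mk_one hT
  simpa using (h.iterate n).dist_le_mul a b

/-- For a nonexpansive map `T` on a metric space, for every `u` and every `v ∈ ω(u)`, the
ω-limit set of `u` is the closure of the forward orbit `{T^[n] v : n ∈ ℕ}`; in particular the
restriction of `T` to `ω(u)` is minimal. -/
theorem omegaLimit_eq_closure_orbit_of_nonexpansive {X : Type*} [MetricSpace X] (T : X → X)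
    (hT : ∀ a b : X, dist (T a) (T b) ≤ dist a b) (u v : X) (hv : v ∈ omegaLimitSet T u) :
    omegaLimitSet T u = closure (Set.range fun n : ℕ => T^[n] v) := by
  ext w
  rw [Metric.mem_closure_range_iff]
  constructor
  · intro hw ε hε
    obtain ⟨k, -, hk⟩ := hv (ε / 2) (half_pos hε) 0
    obtain ⟨m, hkm, hm⟩ := hw (ε / 2) (half_pos hε) k
    have h := dist_iterate_le_of_nonexpansive hT (m - k) (T^[k] u) v
    rw [← Function.iterate_add_apply, Nat.sub_add_cancel hkm] at h
    refine ⟨m - k, ?_⟩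
    linarith [dist_triangle_left w (T^[m - k] v) (T^[m] u)]
  · intro hw ε hε N
    obtain ⟨n, hn⟩ := hw (ε / 2) (half_pos hε)
    obtain ⟨k, hNk, hk⟩ := hv (ε / 2) (half_pos hε) N
    have h := dist_iterate_le_of_nonexpansive hT n (T^[k] u) v
    refine ⟨n + k, by omega, ?_⟩
    rw [Function.iterate_add_apply]
    linarith [dist_triangle_right (T^[n] (T^[k] u)) w (T^[n] v)]
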